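/- arXiv:2503.12292 — 3 statements merged into one kernel-verified Lean document; each statement's English description precedes it below -/
import Mathlib

section
/- Let ν < −2, g ∈ ℝ, and let f : (1,∞) → ℝ be continuous with sup_{r>1} r^{λ̃}|f(r)| < ∞ for some λ̃ > 3. Define v(r) := −(1/(ν+2))·[ r^{ν+1} ∫_1^r s^{−ν} f(s) ds + r^{−1} ∫_r^∞ s² f(s) ds ] + ( g + (1/(ν+2)) ∫_1^∞ s² f(s) ds )·r^{ν+1}. Then v is twice continuously differentiable on (1,∞), satisfies −v''(r) − ((1−ν)/r) v'(r) + ((1+ν)/r²) v(r) = f(r) for all r > 1, v extends continuously to r = 1 with v(1) = g, and r·v(r) → 0 as r → ∞. -/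
open MeasureTheory Filter Set

lemma hasDerivAt_primitive_of_continuousOn_Ioi {h : ℝ → ℝ} {a r : ℝ}
    (hc : ContinuousOn h (Ioi a)) (hi : IntervalIntegrable h volume a r) (hr : a < r) :
    HasDerivAt (fun x => ∫ s in a..x, h s) (h r) r :=
  intervalIntegral.integral_hasDerivAt_right hi
    (hc.stronglyMeasurableAtFilter isOpen_Ioi r hr) (hc.continuousAt (Ioi_mem_nhds hr))

lemma tendsto_primitive_nhdsGT {h : ℝ → ℝ} {a b : ℝ} (hab : a < b)
    (hi : IntervalIntegrable h volume a b) :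
    Tendsto (fun x => ∫ s in a..x, h s) (nhdsWithin a (Ioi a)) (nhds 0) := by
  have hc : ContinuousOn (fun x => ∫ s in a..x, h s) (uIcc a b) :=
    intervalIntegral.continuousOn_primitive_interval' hi left_mem_uIcc
  rw [uIcc_of_le hab.le] at hc
  have := (hc a (left_mem_Icc.2 hab.le)).tendsto
  rw [intervalIntegral.integral_same] at this
  exact this.mono_left (nhdsWithin_le_of_mem (Icc_mem_nhdsGT hab))

lemma integrableOn_sq_mul_of_rpow_mul_abs_le {f : ℝ → ℝ} {l M : ℝ}
    (hf : ContinuousOn f (Ioi 1)) (hl : 3 < l) (hfM : ∀ r : ℝ, 1 < r → r ^ l * |f r| ≤ M) :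
    IntegrableOn (fun s => s ^ 2 * f s) (Ioi 1) := by
  have hg : IntegrableOn (fun s : ℝ => M * s ^ (2 - l)) (Ioi 1) :=
    (integrableOn_Ioi_rpow_of_lt (by linarith) one_pos).const_mul M
  refine Integrable.mono' hg
    (((continuousOn_id.pow 2).mul hf).aestronglyMeasurable measurableSet_Ioi) ?_
  refine (ae_restrict_iff' measurableSet_Ioi).2 (ae_of_all _ fun s (hs : 1 < s) => ?_)
  have hs0 : 0 < s := one_pos.trans hs
  have hsplit : s ^ 2 = s ^ (2 - l) * s ^ l := by
    rw [← Real.rpow_add hs0, sub_add_cancel, Real.rpow_two]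
  rw [Real.norm_eq_abs, abs_mul, abs_of_nonneg (sq_nonneg s), hsplit, mul_assoc, mul_comm M]
  exact mul_le_mul_of_nonneg_left (hfM s hs) (Real.rpow_nonneg hs0.le _)

lemma intervalIntegrable_rpow_mul_of_integrableOn_sq_mul {f : ℝ → ℝ} (p : ℝ) {r : ℝ}
    (hr : 1 < r) (hF : IntegrableOn (fun s => s ^ 2 * f s) (Ioi 1)) :
    IntervalIntegrable (fun s => s ^ p * f s) volume 1 r := by
  have hFi : IntervalIntegrable (fun s => s ^ 2 * f s) volume 1 r :=
    (intervalIntegrable_iff_integrableOn_Ioc_of_le hr.le).2 (hF.mono_set Ioc_subset_Ioi_self)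
  have hc : ContinuousOn (fun s : ℝ => s ^ (p - 2)) (uIcc 1 r) := fun s hs => by
    rw [uIcc_of_le hr.le] at hs
    exact (Real.continuousAt_rpow_const s _
      (Or.inl (one_pos.trans_le hs.1).ne')).continuousWithinAt
  refine (hFi.continuousOn_mul hc).congr fun s hs => ?_
  rw [uIoc_of_le hr.le] at hs
  have hs0 : 0 < s := one_pos.trans hs.1
  rw [← mul_assoc, ← Real.rpow_two, ← Real.rpow_add hs0, sub_add_cancel]

lemma tendsto_rpow_mul_primitive_atTop {f : ℝ → ℝ} {q : ℝ} (hq : 0 < q)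
    (hF : IntegrableOn (fun s => s ^ 2 * f s) (Ioi 1)) :
    Tendsto (fun r : ℝ => r ^ (-q) * ∫ s in (1 : ℝ)..r, s ^ (q + 2) * f s) atTop (nhds 0) := by
  have key : Tendsto (fun r : ℝ => ∫ s in Ioi (1 : ℝ),
      (Iic r).indicator (fun s => (s / r) ^ q * (s ^ 2 * f s)) s) atTop
      (nhds (∫ s in Ioi (1 : ℝ), (0 : ℝ))) := by
    refine tendsto_integral_filter_of_dominated_convergence (fun s => ‖s ^ 2 * f s‖) ?_ ?_
      hF.norm ?_
    · refine Eventually.of_forall fun r => AEStronglyMeasurable.indicator ?_ measurableSet_Iic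
      exact (((measurable_id.div_const r).pow_const q).aestronglyMeasurable).mul
        hF.aestronglyMeasurable
    · filter_upwards [eventually_gt_atTop 1] with r hr
      refine (ae_restrict_iff' measurableSet_Ioi).2 (ae_of_all _ fun s (hs : 1 < s) => ?_)
      have hr0 : 0 < r := one_pos.trans hr
      by_cases hsr : s ≤ r
      · rw [indicator_of_mem (mem_Iic.2 hsr), norm_mul]
        have h0 : 0 ≤ s / r := by positivity
        rw [Real.norm_of_nonneg (Real.rpow_nonneg h0 q)]
        exact mul_le_of_le_one_left (norm_nonneg _)
          (Real.rpow_le_one h0 ((div_le_one hr0).2 hsr) hq.le)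
      · rw [indicator_of_notMem (by simpa using hsr), norm_zero]
        exact norm_nonneg _
    · refine ae_of_all _ fun s => ?_
      have h1 : Tendsto (fun r : ℝ => (s / r) ^ q * (s ^ 2 * f s)) atTop (nhds 0) := by
        have h2 : Tendsto (fun r : ℝ => s / r) atTop (nhds 0) := tendsto_id.const_div_atTop s
        have h3 := (h2.rpow_const (p := q) (Or.inr hq.le)).mul_const (s ^ 2 * f s)
        rwa [Real.zero_rpow hq.ne', zero_mul] at h3
      refine h1.congr' ?_
      filter_upwards [eventually_ge_atTop s] with r hr
      rw [indicator_of_mem (mem_Iic.2 hr)]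
  rw [integral_zero] at key
  refine key.congr' ?_
  filter_upwards [eventually_gt_atTop 1] with r hr
  have hr0 : 0 < r := one_pos.trans hr
  rw [setIntegral_indicator measurableSet_Iic, Ioi_inter_Iic,
    intervalIntegral.integral_of_le hr.le, ← integral_const_mul]
  refine setIntegral_congr_fun measurableSet_Ioc fun s hs => ?_
  have hs0 : 0 < s := one_pos.trans hs.1
  rw [Real.div_rpow hs0.le hr0.le, Real.rpow_neg hr0.le, Real.rpow_add hs0, Real.rpow_two]
  ring

lemma contDiffOn_two_of_hasDerivAt {v v₁ v₂ : ℝ → ℝ} {U : Set ℝ} (hU : IsOpen U)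
    (h₁ : ∀ r ∈ U, HasDerivAt v (v₁ r) r) (h₂ : ∀ r ∈ U, HasDerivAt v₁ (v₂ r) r)
    (hc : ContinuousOn v₂ U) : ContDiffOn ℝ 2 v U := by
  have hv₁ : ContDiffOn ℝ 1 v₁ U := by
    rw [show (1 : WithTop ℕ∞) = 0 + 1 by rfl, contDiffOn_succ_iff_deriv_of_isOpen hU]
    refine ⟨fun r hr => (h₂ r hr).differentiableAt.differentiableWithinAt, by simp, ?_⟩
    exact contDiffOn_zero.2 (hc.congr fun r hr => (h₂ r hr).deriv)
  rw [show (2 : WithTop ℕ∞) = 1 + 1 by rfl, contDiffOn_succ_iff_deriv_of_isOpen hU]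
  exact ⟨fun r hr => (h₁ r hr).differentiableAt.differentiableWithinAt, by simp,
    hv₁.congr fun r hr => (h₁ r hr).deriv⟩

/-- explicit solution formula for the zero Fourier mode of the swirl
velocity, case `ν < -2`. -/
theorem stmt2 (ν g : ℝ) (hν : ν < -2) (f : ℝ → ℝ)
    (hf_cont : ContinuousOn f (Set.Ioi 1))
    (lt : ℝ) (hlt : 3 < lt) (M : ℝ)
    (hfM : ∀ r : ℝ, 1 < r → r ^ lt * |f r| ≤ M)
    (v : ℝ → ℝ)
    (hv : ∀ r : ℝ, v r =
      -(1 / (ν + 2)) * (r ^ (ν + 1) * (∫ s in (1:ℝ)..r, s ^ (-ν) * f s)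
          + r⁻¹ * (∫ s in Set.Ioi r, s ^ 2 * f s))
        + (g + (1 / (ν + 2)) * ∫ s in Set.Ioi (1:ℝ), s ^ 2 * f s) * r ^ (ν + 1)) :
    ContDiffOn ℝ 2 v (Set.Ioi 1)
    ∧ (∀ r : ℝ, 1 < r →
        -(deriv (deriv v) r) - ((1 - ν) / r) * deriv v r + ((1 + ν) / r ^ 2) * v r = f r)
    ∧ Filter.Tendsto v (nhdsWithin 1 (Set.Ioi 1)) (nhds g)
    ∧ Filter.Tendsto (fun r : ℝ => r * v r) Filter.atTop (nhds 0) := by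
  have hν2 : ν + 2 ≠ 0 := by linarith
  have hF := integrableOn_sq_mul_of_rpow_mul_abs_le hf_cont hlt hfM
  have hAi : ∀ r : ℝ, 1 < r → IntervalIntegrable (fun s => s ^ (-ν) * f s) volume 1 r :=
    fun r hr => intervalIntegrable_rpow_mul_of_integrableOn_sq_mul _ hr hF
  have hFi : ∀ r : ℝ, 1 < r → IntervalIntegrable (fun s => s ^ 2 * f s) volume 1 r :=
    fun r hr => (intervalIntegrable_iff_integrableOn_Ioc_of_le hr.le).2
      (hF.mono_set Ioc_subset_Ioi_self)
  have hAc : ContinuousOn (fun s : ℝ => s ^ (-ν) * f s) (Ioi 1) :=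
    ContinuousOn.mul (fun s (hs : 1 < s) => (Real.continuousAt_rpow_const s _
      (Or.inl (one_pos.trans hs).ne')).continuousWithinAt) hf_cont
  have hFc : ContinuousOn (fun s : ℝ => s ^ 2 * f s) (Ioi 1) :=
    (continuousOn_id.pow 2).mul hf_cont
  have hBeq : ∀ r : ℝ, 1 < r → (∫ s in Ioi (1 : ℝ), s ^ 2 * f s) -
      (∫ s in (1 : ℝ)..r, s ^ 2 * f s) = ∫ s in Ioi r, s ^ 2 * f s := fun r hr => by
    rw [← intervalIntegral.integral_Ioi_sub_Ioi hF hr.le]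
    ring
  set A : ℝ → ℝ := fun r => ∫ s in (1 : ℝ)..r, s ^ (-ν) * f s
  set B : ℝ → ℝ := fun r => ∫ s in Ioi r, s ^ 2 * f s
  set C : ℝ := g + (1 / (ν + 2)) * B 1 with hC
  have hv' : ∀ r, v r = -(1 / (ν + 2)) * (r ^ (ν + 1) * A r + r⁻¹ * B r) + C * r ^ (ν + 1) := hv
  have hdA : ∀ r : ℝ, 1 < r → HasDerivAt A (r ^ (-ν) * f r) r := fun r hr =>
    hasDerivAt_primitive_of_continuousOn_Ioi hAc (hAi r hr) hr
  have hdB : ∀ r : ℝ, 1 < r → HasDerivAt B (-(r ^ 2 * f r)) r := fun r hr => by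
    have h := (hasDerivAt_primitive_of_continuousOn_Ioi hFc (hFi r hr) hr).const_sub (B 1)
    refine h.congr_of_eventuallyEq ?_
    filter_upwards [Ioi_mem_nhds hr] with x hx using (hBeq x hx).symm
  let v₁ : ℝ → ℝ := fun r =>
    -(1 / (ν + 2)) * ((ν + 1) * (r ^ ν * A r) - (r ^ 2)⁻¹ * B r) + C * (ν + 1) * r ^ ν
  let v₂ : ℝ → ℝ := fun r =>
    -(1 / (ν + 2)) * ((ν + 1) * ν * (r ^ (ν - 1) * A r) + 2 * (r ^ 3)⁻¹ * B r)
      + C * (ν + 1) * ν * r ^ (ν - 1) - f r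
  have hrpow : ∀ r : ℝ, 1 < r → r ^ ν * r ^ (-ν) = 1 := fun r hr => by
    rw [← Real.rpow_add (one_pos.trans hr), add_neg_cancel, Real.rpow_zero]
  have hd₁ : ∀ r ∈ Ioi (1 : ℝ), HasDerivAt v (v₁ r) r := fun r (hr : 1 < r) => by
    have hr0 : 0 < r := one_pos.trans hr
    have hp : HasDerivAt (fun x : ℝ => x ^ (ν + 1)) ((ν + 1) * r ^ ν) r := by
      simpa using Real.hasDerivAt_rpow_const (x := r) (p := ν + 1) (Or.inl hr0.ne')
    rw [funext hv']
    refine ((((hp.mul (hdA r hr)).add ((hasDerivAt_inv hr0.ne').mul (hdB r hr))).const_mul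
      (-(1 / (ν + 2)))).add (hp.const_mul C)).congr_deriv ?_
    have h1 : r ^ (ν + 1) * (r ^ (-ν) * f r) = r * f r := by
      rw [Real.rpow_add_one hr0.ne']
      linear_combination r * f r * hrpow r hr
    have h2 : r⁻¹ * -(r ^ 2 * f r) = -(r * f r) := by field_simp
    simp only [v₁]
    rw [h1, h2]
    ring
  have hd₂ : ∀ r ∈ Ioi (1 : ℝ), HasDerivAt v₁ (v₂ r) r := fun r (hr : 1 < r) => by
    have hr0 : 0 < r := one_pos.trans hr
    have hp : HasDerivAt (fun x : ℝ => x ^ ν) (ν * r ^ (ν - 1)) r :=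
      Real.hasDerivAt_rpow_const (Or.inl hr0.ne')
    have hi : HasDerivAt (fun x : ℝ => (x ^ 2)⁻¹) (-2 * (r ^ 3)⁻¹) r := by
      refine ((hasDerivAt_pow 2 r).fun_inv (by positivity)).congr_deriv ?_
      field_simp
      norm_num
      ring
    refine (((((hp.mul (hdA r hr)).const_mul (ν + 1)).sub (hi.mul (hdB r hr))).const_mul
      (-(1 / (ν + 2)))).add (hp.const_mul (C * (ν + 1)))).congr_deriv ?_
    have h1 : r ^ ν * (r ^ (-ν) * f r) = f r := by
      linear_combination f r * hrpow r hr
    have h2 : (r ^ 2)⁻¹ * -(r ^ 2 * f r) = -f r := by field_simp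
    simp only [v₂]
    rw [h1, h2]
    field_simp
    ring
  have hc₂ : ContinuousOn v₂ (Ioi 1) := by
    have hAc' : ContinuousOn A (Ioi 1) := fun r hr =>
      (hdA r hr).continuousAt.continuousWithinAt
    have hBc' : ContinuousOn B (Ioi 1) := fun r hr =>
      (hdB r hr).continuousAt.continuousWithinAt
    have hp : ContinuousOn (fun x : ℝ => x ^ (ν - 1)) (Ioi 1) := fun s (hs : 1 < s) =>
      (Real.continuousAt_rpow_const s _ (Or.inl (one_pos.trans hs).ne')).continuousWithinAt
    have hi : ContinuousOn (fun x : ℝ => (x ^ 3)⁻¹) (Ioi 1) :=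
      (continuousOn_id.pow 3).inv₀ fun s (hs : 1 < s) => (pow_pos (one_pos.trans hs) 3).ne'
    simp only [v₂]
    fun_prop
  refine ⟨contDiffOn_two_of_hasDerivAt isOpen_Ioi hd₁ hd₂ hc₂, fun r hr => ?_, ?_, ?_⟩
  · have hr0 : 0 < r := one_pos.trans hr
    have hdd : deriv (deriv v) r = v₂ r := by
      rw [← (hd₂ r hr).deriv]
      refine EventuallyEq.deriv_eq ?_
      filter_upwards [Ioi_mem_nhds hr] with x hx using (hd₁ x hx).deriv
    rw [hdd, (hd₁ r hr).deriv, hv']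
    have e1 : r ^ ν = r ^ (ν - 1) * r := by
      rw [← Real.rpow_add_one hr0.ne', sub_add_cancel]
    simp only [v₁, v₂]
    rw [Real.rpow_add_one hr0.ne', e1]
    field_simp
    ring
  · have hA1 : Tendsto A (nhdsWithin 1 (Ioi 1)) (nhds 0) :=
      tendsto_primitive_nhdsGT one_lt_two (hAi 2 one_lt_two)
    have hB1 : Tendsto B (nhdsWithin 1 (Ioi 1)) (nhds (B 1)) := by
      have h := (tendsto_primitive_nhdsGT one_lt_two (hFi 2 one_lt_two)).const_sub (B 1)
      rw [sub_zero] at h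
      refine h.congr' ?_
      filter_upwards [self_mem_nhdsWithin] with x hx using hBeq x hx
    have hp : Tendsto (fun x : ℝ => x ^ (ν + 1)) (nhdsWithin 1 (Ioi 1)) (nhds 1) := by
      have h := (Real.continuousAt_rpow_const 1 (ν + 1) (Or.inl one_ne_zero)).tendsto
      rw [Real.one_rpow] at h
      exact h.mono_left nhdsWithin_le_nhds
    have hi : Tendsto (fun x : ℝ => x⁻¹) (nhdsWithin 1 (Ioi 1)) (nhds 1) := by
      have h := (continuousAt_inv₀ (one_ne_zero (α := ℝ))).tendsto
      rw [inv_one] at h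
      exact h.mono_left nhdsWithin_le_nhds
    rw [funext hv']
    convert (((hp.mul hA1).add (hi.mul hB1)).const_mul (-(1 / (ν + 2)))).add
      (hp.const_mul C) using 2
    rw [hC]
    ring
  · have hAt : Tendsto (fun r : ℝ => r ^ (ν + 2) * A r) atTop (nhds 0) := by
      have h := tendsto_rpow_mul_primitive_atTop (q := -(ν + 2)) (by linarith) hF
      rw [neg_neg, show -(ν + 2) + 2 = -ν by ring] at h
      exact h
    have hBt : Tendsto B atTop (nhds 0) := by
      have h := (intervalIntegral_tendsto_integral_Ioi 1 hF tendsto_id).const_sub (B 1)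
      rw [show B 1 - ∫ s in Ioi (1 : ℝ), s ^ 2 * f s = 0 from sub_self _] at h
      refine h.congr' ?_
      filter_upwards [eventually_gt_atTop 1] with x hx using hBeq x hx
    have hp : Tendsto (fun r : ℝ => r ^ (ν + 2)) atTop (nhds 0) := by
      simpa using tendsto_rpow_neg_atTop (y := -(ν + 2)) (by linarith)
    have h := ((hAt.add hBt).const_mul (-(1 / (ν + 2)))).add (hp.const_mul C)
    simp only [add_zero, mul_zero] at h
    refine h.congr' ?_
    filter_upwards [eventually_gt_atTop 0] with r hr
    rw [hv', show ν + 2 = ν + 1 + 1 by ring, Real.rpow_add_one hr.ne' (ν + 1)]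
    field_simp
end

section
/- Let ν < −2 and λ̃ ∈ (3, 2−ν/2]. There exists a constant C = C(ν,λ̃) > 0 such that for every g ∈ ℝ and every continuous f : (1,∞) → ℝ with ‖f‖_{L^∞_{λ̃}} < ∞, the function v(r) := −(1/(ν+2))·[ r^{ν+1} ∫_1^r s^{−ν} f(s) ds + r^{−1} ∫_r^∞ s² f(s) ds ] + ( g + (1/(ν+2)) ∫_1^∞ s² f(s) ds )·r^{ν+1} satisfies ‖v''‖_{L^∞_{λ̃}} + ‖v'‖_{L^∞_{λ̃−1}} + ‖v‖_{L^∞_{λ̃−2}} ≤ C ( ‖f‖_{L^∞_{λ̃}} + |g| ). -/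
open MeasureTheory Filter Set

/-- Weighted `L^∞` norm: `‖s‖_{L^∞_ζ} = sup_{r>1} r^ζ |s(r)|`. -/
noncomputable def wnorm (ζ : ℝ) (f : ℝ → ℝ) : ℝ :=
  ⨆ r : Set.Ioi (1:ℝ), (r : ℝ) ^ ζ * |f (r : ℝ)|

/-- The prototype `α x^e I(x) + β x^(e-ν-2) J(x) + γ x^e` of the solution and its derivatives. -/
noncomputable def greenForm (ν α β γ e : ℝ) (I J : ℝ → ℝ) (x : ℝ) : ℝ :=
  α * x ^ e * I x + β * x ^ (e - ν - 2) * J x + γ * x ^ e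

theorem hasDerivAt_greenForm (ν α β γ e : ℝ) {I J : ℝ → ℝ} {r y : ℝ} (hr : 0 < r)
    (hI : HasDerivAt I (r ^ (-ν) * y) r) (hJ : HasDerivAt J (-(r ^ 2 * y)) r) :
    HasDerivAt (greenForm ν α β γ e I J)
      (greenForm ν (α * e) (β * (e - ν - 2)) (γ * e) (e - 1) I J r
        + (α - β) * r ^ (e - ν) * y) r := by
  have he := Real.hasDerivAt_rpow_const (x := r) (p := e) (Or.inl hr.ne')
  have hm := Real.hasDerivAt_rpow_const (x := r) (p := e - ν - 2) (Or.inl hr.ne')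
  have h := (((he.const_mul α).mul hI).add ((hm.const_mul β).mul hJ)).add (he.const_mul γ)
  have h1 : r ^ (e - ν) = r ^ e * r ^ (-ν) := by
    rw [← Real.rpow_add hr, sub_eq_add_neg]
  have h2 : r ^ (e - ν) = r ^ (e - ν - 2) * r ^ 2 := by
    rw [← Real.rpow_natCast r 2, ← Real.rpow_add hr]
    norm_num
  have h3 : e - 1 - ν - 2 = e - ν - 2 - 1 := by ring
  refine HasDerivAt.congr_deriv (f := greenForm ν α β γ e I J) h ?_
  simp only [greenForm, h3]
  linear_combination (-α * y) * h1 + (β * y) * h2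

theorem rpow_mul_abs_greenForm_le {ν lt α β γ e p q A B : ℝ} {I J : ℝ → ℝ} {r : ℝ} (hr : 1 < r)
    (hp : p = 1 - ν - lt) (hq : q = lt - 3) (hp0 : 0 < p)
    (hI : |I r| ≤ A * r ^ p) (hJ : |J r| ≤ B * r ^ (-q)) :
    r ^ (lt - 1 + ν - e) * |greenForm ν α β γ e I J r| ≤ |α| * A + |β| * B + |γ| := by
  have hr0 : 0 < r := by linarith
  have h1 : r ^ (lt - 1 + ν - e) * r ^ e * r ^ p = 1 := by
    rw [← Real.rpow_add hr0, ← Real.rpow_add hr0, hp]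
    ring_nf
    exact Real.rpow_zero r
  have h2 : r ^ (lt - 1 + ν - e) * r ^ (e - ν - 2) * r ^ (-q) = 1 := by
    rw [← Real.rpow_add hr0, ← Real.rpow_add hr0, hq]
    ring_nf
    exact Real.rpow_zero r
  have h3 : r ^ (lt - 1 + ν - e) * r ^ e ≤ 1 := by
    rw [← Real.rpow_add hr0]
    exact Real.rpow_le_one_of_one_le_of_nonpos hr.le (by linarith)
  have habs : |greenForm ν α β γ e I J r| ≤
      |α| * r ^ e * (A * r ^ p) + |β| * r ^ (e - ν - 2) * (B * r ^ (-q)) + |γ| * r ^ e := by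
    refine (abs_add_three _ _ _).trans ?_
    simp only [abs_mul, abs_of_pos (Real.rpow_pos_of_pos hr0 _)]
    gcongr
  calc r ^ (lt - 1 + ν - e) * |greenForm ν α β γ e I J r|
      ≤ r ^ (lt - 1 + ν - e) * (|α| * r ^ e * (A * r ^ p)
          + |β| * r ^ (e - ν - 2) * (B * r ^ (-q)) + |γ| * r ^ e) := by gcongr
    _ = |α| * A * (r ^ (lt - 1 + ν - e) * r ^ e * r ^ p)
          + |β| * B * (r ^ (lt - 1 + ν - e) * r ^ (e - ν - 2) * r ^ (-q))
          + |γ| * (r ^ (lt - 1 + ν - e) * r ^ e) := by ring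
    _ ≤ |α| * A + |β| * B + |γ| := by
      rw [h1, h2]
      nlinarith [abs_nonneg γ]

theorem wnorm_le {ζ B : ℝ} {s : ℝ → ℝ} (h : ∀ r, 1 < r → r ^ ζ * |s r| ≤ B) : wnorm ζ s ≤ B :=
  haveI : Nonempty (Set.Ioi (1 : ℝ)) := ⟨⟨2, by norm_num⟩⟩
  ciSup_le fun r => h r r.2

theorem wnorm_nonneg (ζ : ℝ) (s : ℝ → ℝ) : 0 ≤ wnorm ζ s :=
  Real.iSup_nonneg fun r => mul_nonneg
    (Real.rpow_nonneg (zero_le_one.trans (le_of_lt r.2)) _) (abs_nonneg _)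

theorem abs_le_of_rpow_mul_abs_le {ζ M r y : ℝ} (hr : 0 < r) (h : r ^ ζ * |y| ≤ M) :
    |y| ≤ M * r ^ (-ζ) := by
  rw [Real.rpow_neg hr.le, ← div_eq_mul_inv, le_div_iff₀ (Real.rpow_pos_of_pos hr _)]
  linarith

section Integrals

variable {ζ M : ℝ} {f : ℝ → ℝ}

theorem abs_rpow_mul_le (hf : ∀ r, 1 < r → |f r| ≤ M * r ^ (-ζ)) (a : ℝ) {s : ℝ} (hs : 1 < s) :
    ‖s ^ a * f s‖ ≤ M * s ^ (a - ζ) := by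
  have hs0 : 0 < s := by linarith
  rw [Real.norm_eq_abs, abs_mul, abs_of_pos (Real.rpow_pos_of_pos hs0 _), sub_eq_add_neg,
    Real.rpow_add hs0]
  nlinarith [mul_le_mul_of_nonneg_left (hf s hs) (Real.rpow_pos_of_pos hs0 a).le]

theorem continuousOn_rpow_mul (hc : ContinuousOn f (Set.Ioi 1)) (a : ℝ) :
    ContinuousOn (fun s => s ^ a * f s) (Set.Ioi 1) :=
  ContinuousOn.mul (fun s hs => (Real.continuousAt_rpow_const s a
    (Or.inl (zero_lt_one.trans hs).ne')).continuousWithinAt) hc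

theorem intervalIntegrable_rpow_mul (hc : ContinuousOn f (Set.Ioi 1))
    (hf : ∀ r, 1 < r → |f r| ≤ M * r ^ (-ζ)) (a : ℝ) {r : ℝ} (hr : 1 ≤ r) :
    IntervalIntegrable (fun s => s ^ a * f s) volume 1 r := by
  have hg : IntervalIntegrable (fun s : ℝ => M * s ^ (a - ζ)) volume 1 r := by
    refine (intervalIntegral.intervalIntegrable_rpow (Or.inr ?_)).const_mul M
    rw [Set.uIcc_of_le hr]
    exact fun h => by linarith [h.1]
  rw [intervalIntegrable_iff_integrableOn_Ioc_of_le hr] at hg ⊢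
  refine hg.mono' (((continuousOn_rpow_mul hc a).mono Ioc_subset_Ioi_self).aestronglyMeasurable
    measurableSet_Ioc) ?_
  exact (ae_restrict_iff' measurableSet_Ioc).2 (.of_forall fun s hs => abs_rpow_mul_le hf a hs.1)

theorem hasDerivAt_integral_rpow_mul (hc : ContinuousOn f (Set.Ioi 1))
    (hf : ∀ r, 1 < r → |f r| ≤ M * r ^ (-ζ)) (a : ℝ) {r : ℝ} (hr : 1 < r) :
    HasDerivAt (fun x => ∫ s in (1 : ℝ)..x, s ^ a * f s) (r ^ a * f r) r :=
  intervalIntegral.integral_hasDerivAt_right (intervalIntegrable_rpow_mul hc hf a hr.le)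
    ((continuousOn_rpow_mul hc a).stronglyMeasurableAtFilter isOpen_Ioi r hr)
    ((continuousOn_rpow_mul hc a).continuousAt (Ioi_mem_nhds hr))

theorem abs_integral_rpow_mul_le (hM : 0 ≤ M) (hf : ∀ r, 1 < r → |f r| ≤ M * r ^ (-ζ)) {a p : ℝ}
    (hp : p = 1 + a - ζ) (hp0 : 0 < p) {r : ℝ} (hr : 1 ≤ r) :
    |∫ s in (1 : ℝ)..r, s ^ a * f s| ≤ M / p * r ^ p := by
  have h := intervalIntegral.norm_integral_le_of_norm_le (μ := volume) hr
    (.of_forall fun s (hs : s ∈ Set.Ioc 1 r) => abs_rpow_mul_le hf a hs.1)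
    ((intervalIntegral.intervalIntegrable_rpow' (by linarith)).const_mul M)
  rw [intervalIntegral.integral_const_mul, integral_rpow (Or.inl (by linarith)),
    Real.one_rpow, show a - ζ + 1 = p by linarith] at h
  have h2 : M * ((r ^ p - 1) / p) ≤ M * (r ^ p / p) := by gcongr; linarith
  calc _ ≤ _ := h
    _ ≤ _ := h2
    _ = _ := by ring

theorem integrableOn_Ioi_rpow_mul (hc : ContinuousOn f (Set.Ioi 1))
    (hf : ∀ r, 1 < r → |f r| ≤ M * r ^ (-ζ)) {a : ℝ} (ha : a - ζ < -1) {r : ℝ} (hr : 1 ≤ r) :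
    IntegrableOn (fun s => s ^ a * f s) (Set.Ioi r) := by
  refine ((integrableOn_Ioi_rpow_of_lt ha (by linarith : 0 < r)).const_mul M).mono'
    (((continuousOn_rpow_mul hc a).mono (Ioi_subset_Ioi hr)).aestronglyMeasurable
      measurableSet_Ioi) ?_
  exact (ae_restrict_iff' measurableSet_Ioi).2
    (.of_forall fun s hs => abs_rpow_mul_le hf a (lt_of_le_of_lt hr hs))

theorem abs_integral_Ioi_rpow_mul_le (hf : ∀ r, 1 < r → |f r| ≤ M * r ^ (-ζ)) {a q : ℝ}
    (hq : q = ζ - a - 1) (hq0 : 0 < q) {r : ℝ} (hr : 1 ≤ r) :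
    |∫ s in Set.Ioi r, s ^ a * f s| ≤ M / q * r ^ (-q) := by
  have hr0 : 0 < r := by linarith
  have h := norm_integral_le_of_norm_le
    ((integrableOn_Ioi_rpow_of_lt (by linarith : a - ζ < -1) hr0).const_mul M)
    ((ae_restrict_iff' measurableSet_Ioi).2
      (.of_forall fun s hs => abs_rpow_mul_le hf a (lt_of_le_of_lt hr hs)))
  rw [integral_const_mul, integral_Ioi_rpow_of_lt (by linarith) hr0,
    show a - ζ + 1 = -q by linarith] at h
  refine h.trans_eq ?_
  field_simp

theorem hasDerivAt_integral_Ioi_rpow_mul (hc : ContinuousOn f (Set.Ioi 1))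
    (hf : ∀ r, 1 < r → |f r| ≤ M * r ^ (-ζ)) {a : ℝ} (ha : a - ζ < -1) {r : ℝ} (hr : 1 < r) :
    HasDerivAt (fun x => ∫ s in Set.Ioi x, s ^ a * f s) (-(r ^ a * f r)) r := by
  refine ((hasDerivAt_integral_rpow_mul hc hf a hr).const_sub
    (∫ s in Set.Ioi (1 : ℝ), s ^ a * f s)).congr_of_eventuallyEq ?_
  filter_upwards [Ioi_mem_nhds hr] with x hx
  have := intervalIntegral.integral_interval_add_Ioi
    (integrableOn_Ioi_rpow_mul hc hf ha le_rfl)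
    (integrableOn_Ioi_rpow_mul hc hf ha (le_of_lt hx))
  linarith

end Integrals

/-- weighted estimate for the zero mode of the swirl velocity, case `ν < -2`. -/
theorem stmt3 (ν lt : ℝ) (hν : ν < -2) (hlt1 : 3 < lt) (hlt2 : lt ≤ 2 - ν / 2) :
    ∃ C > 0, ∀ (g : ℝ) (f : ℝ → ℝ), ContinuousOn f (Set.Ioi 1) →
      BddAbove (Set.range fun r : Set.Ioi (1:ℝ) => (r : ℝ) ^ lt * |f (r : ℝ)|) →
      ∀ v : ℝ → ℝ,
        (∀ r : ℝ, v r =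
          -(1 / (ν + 2)) * (r ^ (ν + 1) * (∫ s in (1:ℝ)..r, s ^ (-ν) * f s)
              + r⁻¹ * (∫ s in Set.Ioi r, s ^ 2 * f s))
            + (g + (1 / (ν + 2)) * ∫ s in Set.Ioi (1:ℝ), s ^ 2 * f s) * r ^ (ν + 1)) →
        wnorm lt (deriv (deriv v)) + wnorm (lt - 1) (deriv v) + wnorm (lt - 2) v
          ≤ C * (wnorm lt f + |g|) := by
  obtain ⟨p, hp⟩ : ∃ p, p = 1 - ν - lt := ⟨_, rfl⟩
  obtain ⟨q, hq⟩ : ∃ q, q = lt - 3 := ⟨_, rfl⟩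
  obtain ⟨c, hc⟩ : ∃ c, c = 1 / (ν + 2) := ⟨_, rfl⟩
  have hp0 : 0 < p := by linarith
  have hq0 : 0 < q := by linarith
  have hcν : c * (ν + 2) = 1 := by
    rw [hc]
    exact one_div_mul_cancel (by linarith)
  let D (α β γ : ℝ) : ℝ := |α| / p + |β| / q + |γ| * (1 + |c| / q)
  have hD (α β γ : ℝ) : 0 ≤ D α β γ := by positivity
  have hpos : 0 < (D (-c * (ν + 1) * ν) (c * -2) ((ν + 1) * ν) + 1)
      + D (-c * (ν + 1)) c (ν + 1) + D (-c) (-c) 1 := by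
    linarith [hD (-c * (ν + 1) * ν) (c * -2) ((ν + 1) * ν), hD (-c * (ν + 1)) c (ν + 1),
      hD (-c) (-c) 1]
  refine ⟨_, hpos, ?_⟩
  intro g f hfc hbdd v hv
  obtain ⟨M, hM⟩ : ∃ M, M = wnorm lt f := ⟨_, rfl⟩
  have hM0 : 0 ≤ M := hM ▸ wnorm_nonneg lt f
  have hfM : ∀ r, 1 < r → r ^ lt * |f r| ≤ M := fun r hr =>
    hM ▸ le_ciSup hbdd (⟨r, hr⟩ : Set.Ioi (1 : ℝ))
  have hf : ∀ r, 1 < r → |f r| ≤ M * r ^ (-lt) := fun r hr =>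
    abs_le_of_rpow_mul_abs_le (by linarith) (hfM r hr)
  let I : ℝ → ℝ := fun x => ∫ s in (1 : ℝ)..x, s ^ (-ν) * f s
  let J : ℝ → ℝ := fun x => ∫ s in Set.Ioi x, s ^ (2 : ℝ) * f s
  let K : ℝ := g + c * J 1
  have hI (r : ℝ) (hr : 1 < r) : |I r| ≤ M / p * r ^ p :=
    abs_integral_rpow_mul_le hM0 hf (by linarith) hp0 hr.le
  have hJ (r : ℝ) (hr : 1 ≤ r) : |J r| ≤ M / q * r ^ (-q) :=
    abs_integral_Ioi_rpow_mul_le hf (by linarith) hq0 hr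
  have hI' (r : ℝ) (hr : 1 < r) : HasDerivAt I (r ^ (-ν) * f r) r :=
    hasDerivAt_integral_rpow_mul hfc hf _ hr
  have hJ' (r : ℝ) (hr : 1 < r) : HasDerivAt J (-(r ^ 2 * f r)) r := by
    have := hasDerivAt_integral_Ioi_rpow_mul hfc hf (a := 2) (by linarith) hr
    rwa [Real.rpow_two] at this
  have hK : |K| ≤ |g| + |c| * (M / q) := by
    have h1 := hJ 1 le_rfl
    rw [Real.one_rpow, mul_one] at h1
    calc |K| ≤ |g| + |c * J 1| := abs_add_le _ _
      _ ≤ _ := by rw [abs_mul]; gcongr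
  have bound (α β γ e r : ℝ) (hr : 1 < r) :
      r ^ (lt - 1 + ν - e) * |greenForm ν α β (K * γ) e I J r| ≤ D α β γ * (M + |g|) := by
    refine (rpow_mul_abs_greenForm_le hr hp hq hp0 (hI r hr) (hJ r hr.le)).trans ?_
    have h1 : |K * γ| ≤ |γ| * (|g| + |c| * (M / q)) := by
      rw [abs_mul, mul_comm]
      gcongr
    have h2 : 0 ≤ (|α| / p + |β| / q + |γ| * (|c| / q)) * |g| + |γ| * M := by positivity
    calc _ ≤ |α| * (M / p) + |β| * (M / q) + |γ| * (|g| + |c| * (M / q)) := by gcongr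
      _ ≤ _ + ((|α| / p + |β| / q + |γ| * (|c| / q)) * |g| + |γ| * M) := le_add_of_nonneg_right h2
      _ = _ := by simp only [D]; ring
  have hv0 : v = fun r => greenForm ν (-c) (-c) (K * 1) (ν + 1) I J r := by
    funext r
    rw [hv r]
    simp only [greenForm, I, J, K, Real.rpow_two, hc, show ν + 1 - ν - 2 = -1 by ring,
      Real.rpow_neg_one]
    ring
  have hv1 (r : ℝ) (hr : 1 < r) :
      deriv v r = greenForm ν (-c * (ν + 1)) c (K * (ν + 1)) ν I J r := by
    rw [hv0, (hasDerivAt_greenForm ν (-c) (-c) (K * 1) (ν + 1) (by linarith)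
      (hI' r hr) (hJ' r hr)).deriv]
    ring_nf
  have hv2 (r : ℝ) (hr : 1 < r) : deriv (deriv v) r =
      greenForm ν (-c * (ν + 1) * ν) (c * -2) (K * ((ν + 1) * ν)) (ν - 1) I J r - f r := by
    have heq : deriv v =ᶠ[nhds r] greenForm ν (-c * (ν + 1)) c (K * (ν + 1)) ν I J := by
      filter_upwards [Ioi_mem_nhds hr] with x hx using hv1 x hx
    rw [heq.deriv_eq, (hasDerivAt_greenForm ν (-c * (ν + 1)) c (K * (ν + 1)) ν (by linarith)
      (hI' r hr) (hJ' r hr)).deriv, sub_self, Real.rpow_zero, zero_sub, mul_assoc K]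
    linear_combination (-f r) * hcν
  have b0 : wnorm (lt - 2) v ≤ D (-c) (-c) 1 * (M + |g|) := wnorm_le fun r hr => by
    have h := bound (-c) (-c) 1 (ν + 1) r hr
    rw [show lt - 1 + ν - (ν + 1) = lt - 2 by ring] at h
    rw [hv0]
    exact h
  have b1 : wnorm (lt - 1) (deriv v) ≤ D (-c * (ν + 1)) c (ν + 1) * (M + |g|) :=
    wnorm_le fun r hr => by
      have := bound (-c * (ν + 1)) c (ν + 1) ν r hr
      rwa [show lt - 1 + ν - ν = lt - 1 by ring, ← hv1 r hr] at this
  have b2 : wnorm lt (deriv (deriv v)) ≤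
      (D (-c * (ν + 1) * ν) (c * -2) ((ν + 1) * ν) + 1) * (M + |g|) := wnorm_le fun r hr => by
    have h := bound (-c * (ν + 1) * ν) (c * -2) ((ν + 1) * ν) (ν - 1) r hr
    rw [show lt - 1 + ν - (ν - 1) = lt by ring] at h
    have h0 : 0 ≤ r ^ lt := Real.rpow_nonneg (by linarith) _
    rw [hv2 r hr]
    have := mul_le_mul_of_nonneg_left (abs_sub
      (greenForm ν (-c * (ν + 1) * ν) (c * -2) (K * ((ν + 1) * ν)) (ν - 1) I J r) (f r)) h0
    linarith [hfM r hr, abs_nonneg g]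
  rw [← hM]
  linarith
end

section
/- Let −2 ≤ ν < 0 and λ̃ > 3, and let f : (1,∞) → ℝ be continuous with ‖f‖_{L^∞_{λ̃}} < ∞. Then the function 𝗏(r) := −(1/r) ∫_r^∞ s^{ν+1} ( ∫_s^∞ t^{−ν} f(t) dt ) ds satisfies, for every r > 1, the explicit bound r^{λ̃−2} |𝗏(r)| ≤ ‖f‖_{L^∞_{λ̃}} / ( (ν+λ̃−1)(λ̃−3) ). -/
open MeasureTheory Filter Set

/-- A function dominated by `C * t ^ p` with `p < -1` has a tail integral bounded by
the tail integral of the power. -/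
theorem abs_setIntegral_Ioi_le_of_abs_le_rpow {p c C : ℝ} (hp : p < -1) (hc : 0 < c) {g : ℝ → ℝ}
    (hg : ∀ t, c < t → |g t| ≤ C * t ^ p) :
    |∫ t in Ioi c, g t| ≤ C / (-p - 1) * c ^ (p + 1) := by
  have hint : IntegrableOn (fun t : ℝ => C * t ^ p) (Ioi c) :=
    (integrableOn_Ioi_rpow_of_lt hp hc).const_mul C
  have hle : ‖∫ t in Ioi c, g t‖ ≤ ∫ t in Ioi c, C * t ^ p :=
    norm_integral_le_of_norm_le hint
      ((ae_restrict_iff' measurableSet_Ioi).2 (ae_of_all _ fun t ht => hg t ht))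
  rw [integral_const_mul, integral_Ioi_rpow_of_lt hp hc] at hle
  have h1 : p + 1 ≠ 0 := by linarith
  have h2 : -p - 1 ≠ 0 := by linarith
  have heq : C / (-p - 1) * c ^ (p + 1) = C * (-c ^ (p + 1) / (p + 1)) := by
    rw [show -p - 1 = -(p + 1) by ring]
    field_simp
  rw [heq]
  exact hle

/-- A function with bounded weight is dominated by its weighted norm times the inverse weight. -/
theorem abs_le_wnorm_mul_rpow_neg {ζ : ℝ} {f : ℝ → ℝ}
    (hf : BddAbove (range fun r : Ioi (1 : ℝ) => (r : ℝ) ^ ζ * |f (r : ℝ)|))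
    {t : ℝ} (ht : 1 < t) : |f t| ≤ wnorm ζ f * t ^ (-ζ) := by
  have h0 : 0 < t := by linarith
  have hle : t ^ ζ * |f t| ≤ wnorm ζ f := le_ciSup hf (⟨t, ht⟩ : Ioi (1 : ℝ))
  rw [Real.rpow_neg h0.le, ← div_eq_mul_inv, le_div_iff₀ (Real.rpow_pos_of_pos h0 _)]
  linarith

/-- explicit pointwise bound for the decaying part of the zero mode of
the swirl velocity, case `-2 ≤ ν < 0`. -/
theorem stmt6 (ν lt : ℝ) (hν1 : -2 ≤ ν) (hν2 : ν < 0) (hlt : 3 < lt)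
    (f : ℝ → ℝ) (hf_cont : ContinuousOn f (Set.Ioi 1))
    (hf_bdd : BddAbove (Set.range fun r : Set.Ioi (1:ℝ) => (r : ℝ) ^ lt * |f (r : ℝ)|))
    (vv : ℝ → ℝ)
    (hvv : ∀ r : ℝ, vv r =
      -(1 / r) * ∫ s in Set.Ioi r, s ^ (ν + 1) * ∫ t in Set.Ioi s, t ^ (-ν) * f t) :
    ∀ r : ℝ, 1 < r →
      r ^ (lt - 2) * |vv r| ≤ wnorm lt f / ((ν + lt - 1) * (lt - 3)) := by
  intro r hr
  have hr0 : 0 < r := by linarith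
  have inner_bound : ∀ s, 1 < s → |∫ t in Ioi s, t ^ (-ν) * f t| ≤
      wnorm lt f / (ν + lt - 1) * s ^ (-ν - lt + 1) := by
    intro s hs
    have h := abs_setIntegral_Ioi_le_of_abs_le_rpow (p := -ν - lt) (c := s) (C := wnorm lt f)
      (g := fun t => t ^ (-ν) * f t) (by linarith) (by linarith) fun t ht => by
        have ht0 : 0 < t := by linarith
        rw [abs_mul, abs_of_pos (Real.rpow_pos_of_pos ht0 _), sub_eq_add_neg,
          Real.rpow_add ht0, mul_left_comm]
        exact mul_le_mul_of_nonneg_left (abs_le_wnorm_mul_rpow_neg hf_bdd (hs.trans ht))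
          (Real.rpow_pos_of_pos ht0 _).le
    rwa [show -(-ν - lt) - 1 = ν + lt - 1 by ring] at h
  have outer_bound := abs_setIntegral_Ioi_le_of_abs_le_rpow (p := 2 - lt) (c := r)
    (C := wnorm lt f / (ν + lt - 1))
    (g := fun s => s ^ (ν + 1) * ∫ t in Ioi s, t ^ (-ν) * f t) (by linarith) hr0 fun s hs => by
      have hs0 : 0 < s := by linarith
      rw [abs_mul, abs_of_pos (Real.rpow_pos_of_pos hs0 _),
        show 2 - lt = (ν + 1) + (-ν - lt + 1) by ring,
        Real.rpow_add hs0 (ν + 1) (-ν - lt + 1), mul_left_comm]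
      exact mul_le_mul_of_nonneg_left (inner_bound s (hr.trans hs))
        (Real.rpow_pos_of_pos hs0 _).le
  have hw : r ^ (lt - 2) * (1 / r) * r ^ (2 - lt + 1) = 1 := by
    rw [one_div, ← Real.rpow_neg_one, ← Real.rpow_add hr0, ← Real.rpow_add hr0,
      show lt - 2 + -1 + (2 - lt + 1) = 0 by ring, Real.rpow_zero]
  rw [hvv r, abs_mul, abs_neg, abs_of_pos (one_div_pos.2 hr0), ← mul_assoc]
  calc _ ≤ r ^ (lt - 2) * (1 / r) *
        (wnorm lt f / (ν + lt - 1) / (-(2 - lt) - 1) * r ^ (2 - lt + 1)) :=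
        mul_le_mul_of_nonneg_left outer_bound (by positivity)
    _ = wnorm lt f / (ν + lt - 1) / (-(2 - lt) - 1) *
        (r ^ (lt - 2) * (1 / r) * r ^ (2 - lt + 1)) := by ring
    _ = wnorm lt f / ((ν + lt - 1) * (lt - 3)) := by
        rw [hw, mul_one, div_div, show -(2 - lt) - 1 = lt - 3 by ring]
end
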